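/- arXiv:2111.05947 — 6 statements merged into one kernel-verified Lean document; each statement's English description precedes it below -/
import Mathlib

section
/- (Best Response: Encoder) Fix decoder parameters (δ₁,δ₂) ∈ [0,1]² and (ε₁,ε₂) ∈ [0,1]² and a weight ρ > 0. Define g : [0,1]² → ℝ by g(κ₁,κ₂) = f(P₁(κ₁,κ₂), P₂(κ₁,κ₂)) + ρ·D(κ₁,κ₂,ε₁,ε₂). Then g is convex on [0,1]², and its maximum over [0,1]² is attained at one of the four vertices (κ₁,κ₂) ∈ {(0,0),(0,1),(1,0),(1,1)}. -/
open Real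

/-- The binary entropy function (base-2 logarithms, with the convention
`0 · log₂ 0 = 0`, which holds since `Real.logb 2 0 = 0`). -/
noncomputable def Hb (p : ℝ) : ℝ :=
  -(p * Real.logb 2 p) - (1 - p) * Real.logb 2 (1 - p)

/-- The closed-form mutual-information formula
`f(P₁,P₂) = H_b(q₁) + H_b(P₁+P₂) + P₁ log₂ P₁ + P₂ log₂ P₂
  + (q₁−P₁) log₂(q₁−P₁) + (1−q₁−P₂) log₂(1−q₁−P₂)`. -/
noncomputable def f (q₁ P₁ P₂ : ℝ) : ℝ :=
  Hb q₁ + Hb (P₁ + P₂) + P₁ * Real.logb 2 P₁ + P₂ * Real.logb 2 P₂ +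
    (q₁ - P₁) * Real.logb 2 (q₁ - P₁) + (1 - q₁ - P₂) * Real.logb 2 (1 - q₁ - P₂)

lemma conv_ineq {E : Type*} [AddCommGroup E] [Module ℝ E] {S : Set E} {F : E → ℝ}
    (h : ConvexOn ℝ S F) (x y : E) (hx : x ∈ S) (hy : y ∈ S) (α β : ℝ) (hα : 0 ≤ α)
    (hβ : 0 ≤ β) (hαβ : α + β = 1) : F (α • x + β • y) ≤ α * F x + β * F y :=
  h.2 hx hy hα hβ hαβ

/-- Perspective of `t log t`. -/
noncomputable def Gp (x s : ℝ) : ℝ := x * Real.log (x / s)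

lemma Gp_add {x s x' s' : ℝ} (hx : 0 ≤ x) (hs : x ≤ s) (hx' : 0 ≤ x') (hs' : x' ≤ s') :
    Gp (x + x') (s + s') ≤ Gp x s + Gp x' s' := by
  rcases (hx.trans hs).eq_or_lt with h | h
  · have : x = 0 := by linarith
    subst this
    subst h
    simp [Gp]
  rcases (hx'.trans hs').eq_or_lt with h' | h'
  · have : x' = 0 := by linarith
    subst this
    subst h'
    simp [Gp]
  have hS : 0 < s + s' := by linarith
  have key := conv_ineq Real.convexOn_mul_log (x / s) (x' / s')
    (by simpa using div_nonneg hx h.le) (by simpa using div_nonneg hx' h'.le)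
    (s / (s + s')) (s' / (s + s')) (by positivity) (by positivity)
    (by field_simp)
  have e : s / (s + s') * (x / s) + s' / (s + s') * (x' / s') = (x + x') / (s + s') := by
    field_simp
  simp only [smul_eq_mul] at key
  rw [e] at key
  have k2 := mul_le_mul_of_nonneg_left key hS.le
  unfold Gp
  have e1 : (s + s') * ((x + x') / (s + s') * Real.log ((x + x') / (s + s')))
      = (x + x') * Real.log ((x + x') / (s + s')) := by
    field_simp
  have e2 : (s + s') * (s / (s + s') * (x / s * Real.log (x / s)) +
      s' / (s + s') * (x' / s' * Real.log (x' / s')))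
      = x * Real.log (x / s) + x' * Real.log (x' / s') := by
    field_simp
  linarith

lemma Gp_smul (r x s : ℝ) : Gp (r * x) (r * s) = r * Gp x s := by
  by_cases h : r = 0
  · simp [h, Gp]
  · unfold Gp
    rw [mul_div_mul_left _ _ h, mul_assoc]

lemma Gp_convex {x s x' s' α β : ℝ} (hx : 0 ≤ x) (hs : x ≤ s) (hx' : 0 ≤ x') (hs' : x' ≤ s')
    (hα : 0 ≤ α) (hβ : 0 ≤ β) :
    Gp (α * x + β * x') (α * s + β * s') ≤ α * Gp x s + β * Gp x' s' := by
  rw [← Gp_smul, ← Gp_smul]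
  exact Gp_add (by positivity) (mul_le_mul_of_nonneg_left hs hα) (by positivity)
    (mul_le_mul_of_nonneg_left hs' hβ)

lemma Gp_pair {x y : ℝ} (hx : 0 ≤ x) (hy : 0 ≤ y) :
    Gp x (x + y) + Gp y (x + y) =
      x * Real.log x + y * Real.log y - (x + y) * Real.log (x + y) := by
  unfold Gp
  rcases hx.eq_or_lt with h | h
  · subst h
    by_cases h0 : y = 0 <;> simp [h0]
  rcases hy.eq_or_lt with h' | h'
  · subst h'
    simp [h.ne']
  rw [Real.log_div (by positivity) (by positivity), Real.log_div (by positivity) (by positivity)]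
  ring

lemma f_eq {q x y : ℝ} (hx : 0 ≤ x) (hy : 0 ≤ y) (hx' : x ≤ q) (hy' : y ≤ 1 - q) :
    f q x y = Hb q + (Gp x (x + y) + Gp y (x + y) + Gp (q - x) (1 - (x + y)) +
      Gp (1 - q - y) (1 - (x + y))) / Real.log 2 := by
  have h1 := Gp_pair hx hy
  have h2 := Gp_pair (sub_nonneg.2 hx') (sub_nonneg.2 hy')
  rw [show q - x + (1 - q - y) = 1 - (x + y) by ring] at h2
  rw [add_assoc (Gp x (x + y) + Gp y (x + y)), h1, h2]
  unfold f
  rw [Hb.eq_def (x + y)]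
  simp only [Real.logb]
  ring

lemma f_convex {q x y x' y' α β : ℝ} (hx : 0 ≤ x) (hy : 0 ≤ y) (hxq : x ≤ q) (hyq : y ≤ 1 - q)
    (hx' : 0 ≤ x') (hy' : 0 ≤ y') (hxq' : x' ≤ q) (hyq' : y' ≤ 1 - q)
    (hα : 0 ≤ α) (hβ : 0 ≤ β) (hαβ : α + β = 1) :
    f q (α * x + β * x') (α * y + β * y') ≤ α * f q x y + β * f q x' y' := by
  have hβ' : β = 1 - α := by linarith
  have b1 : α * x + β * x' ≤ q := by
    have := mul_le_mul_of_nonneg_left hxq hα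
    have := mul_le_mul_of_nonneg_left hxq' hβ
    have : α * q + β * q = q := by rw [← add_mul, hαβ, one_mul]
    linarith
  have b2 : α * y + β * y' ≤ 1 - q := by
    have := mul_le_mul_of_nonneg_left hyq hα
    have := mul_le_mul_of_nonneg_left hyq' hβ
    have : α * (1 - q) + β * (1 - q) = 1 - q := by rw [← add_mul, hαβ, one_mul]
    linarith
  rw [f_eq hx hy hxq hyq, f_eq hx' hy' hxq' hyq', f_eq (by positivity) (by positivity) b1 b2]
  have g1 := Gp_convex (x := x) (s := x + y) (x' := x') (s' := x' + y') hx (by linarith) hx'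
    (by linarith) hα hβ
  have g2 := Gp_convex (x := y) (s := x + y) (x' := y') (s' := x' + y') hy (by linarith) hy'
    (by linarith) hα hβ
  have g3 := Gp_convex (x := q - x) (s := 1 - (x + y)) (x' := q - x') (s' := 1 - (x' + y'))
    (by linarith) (by linarith) (by linarith) (by linarith) hα hβ
  have g4 := Gp_convex (x := 1 - q - y) (s := 1 - (x + y)) (x' := 1 - q - y')
    (s' := 1 - (x' + y')) (by linarith) (by linarith) (by linarith) (by linarith) hα hβ
  have s1 : α * x + β * x' + (α * y + β * y') = α * (x + y) + β * (x' + y') := by ring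
  have s2 : 1 - (α * (x + y) + β * (x' + y')) = α * (1 - (x + y)) + β * (1 - (x' + y')) := by
    rw [hβ']; ring
  have s3 : q - (α * x + β * x') = α * (q - x) + β * (q - x') := by
    rw [hβ']; ring
  have s4 : 1 - q - (α * y + β * y') = α * (1 - q - y) + β * (1 - q - y') := by
    rw [hβ']; ring
  rw [s1, s2, s3, s4]
  have hl : 0 < Real.log 2 := Real.log_pos (by norm_num)
  have hH : α * Hb q + β * Hb q = Hb q := by rw [← add_mul, hαβ, one_mul]
  have tot := div_le_div_of_nonneg_right (add_le_add (add_le_add (add_le_add g1 g2) g3) g4) hl.le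
  refine (add_le_add_right tot (Hb q)).trans (le_of_eq ?_)
  rw [← hH]
  ring_nf
  try (rw [hβ']; ring)

/-- A convex combination of two numbers in `[0,1]` is in `[0,1]`. -/
lemma mix_mem {u v k : ℝ} (hu : u ∈ Set.Icc (0 : ℝ) 1) (hv : v ∈ Set.Icc (0 : ℝ) 1)
    (hk : 0 ≤ k) (hk' : k ≤ 1) :
    0 ≤ u * k + v * (1 - k) ∧ u * k + v * (1 - k) ≤ 1 := by
  obtain ⟨u0, u1⟩ := hu
  obtain ⟨v0, v1⟩ := hv
  have h := sub_nonneg.2 hk'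
  constructor
  · positivity
  · have := mul_le_mul_of_nonneg_right u1 hk
    have := mul_le_mul_of_nonneg_right v1 h
    linarith

lemma max_vertex {g : ℝ → ℝ → ℝ}
    (h : ConvexOn ℝ (Set.Icc ((0 : ℝ), (0 : ℝ)) (1, 1)) (fun p : ℝ × ℝ => g p.1 p.2)) :
    ∃ v ∈ ({((0 : ℝ), (0 : ℝ)), (0, 1), (1, 0), (1, 1)} : Set (ℝ × ℝ)),
      ∀ p ∈ Set.Icc ((0 : ℝ), (0 : ℝ)) (1, 1), g p.1 p.2 ≤ g v.1 v.2 := by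
  obtain ⟨v, hv, hm⟩ := Set.exists_max_image
    ({((0 : ℝ), (0 : ℝ)), (0, 1), (1, 0), (1, 1)} : Set (ℝ × ℝ))
    (fun p : ℝ × ℝ => g p.1 p.2) (Set.toFinite _) ⟨(0, 0), by simp⟩
  refine ⟨v, hv, ?_⟩
  rintro ⟨x, y⟩ ⟨⟨hx0, hy0⟩, ⟨hx1, hy1⟩⟩
  simp only at hx0 hy0 hx1 hy1
  have m00 := hm (0, 0) (by simp)
  have m01 := hm (0, 1) (by simp)
  have m10 := hm (1, 0) (by simp)
  have m11 := hm (1, 1) (by simp)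
  simp only at m00 m01 m10 m11 ⊢
  have comb : ∀ {A B k M : ℝ}, A ≤ M → B ≤ M → 0 ≤ k → k ≤ 1 → (1 - k) * A + k * B ≤ M := by
    intro A B k M hA hB hk hk1
    have := mul_le_mul_of_nonneg_left hA (sub_nonneg.2 hk1)
    have := mul_le_mul_of_nonneg_left hB hk
    linarith
  have edge : ∀ t : ℝ, 0 ≤ t → t ≤ 1 → g 0 t ≤ g v.1 v.2 → g 1 t ≤ g v.1 v.2 →
      g x t ≤ g v.1 v.2 := by
    intro t ht0 ht1 h0 h1
    have := conv_ineq h (0, t) (1, t) (by simp [Prod.le_def, ht0, ht1])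
      (by simp [Prod.le_def, ht0, ht1]) (1 - x) x (by linarith) hx0 (by ring)
    simp only [Prod.smul_mk, Prod.mk_add_mk, smul_eq_mul] at this
    rw [show (1 - x) * 0 + x * 1 = x by ring, show (1 - x) * t + x * t = t by ring] at this
    exact this.trans (comb h0 h1 hx0 hx1)
  have e0 := edge 0 le_rfl zero_le_one m00 m10
  have e1 := edge 1 zero_le_one le_rfl m01 m11
  have := conv_ineq h (x, 0) (x, 1) (by simp [Prod.le_def, hx0, hx1])
    (by simp [Prod.le_def, hx0, hx1]) (1 - y) y (by linarith) hy0 (by ring)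
  simp only [Prod.smul_mk, Prod.mk_add_mk, smul_eq_mul] at this
  rw [show (1 - y) * 0 + y * 1 = y by ring, show (1 - y) * x + y * x = x by ring] at this
  exact this.trans (comb e0 e1 hy0 hy1)

/-- (Best Response: Encoder.) For fixed decoder parameters `(δ₁,δ₂)`, `(ε₁,ε₂)`
and weight `ρ > 0`, the encoder objective
`g(κ₁,κ₂) = f(P₁(κ₁,κ₂),P₂(κ₁,κ₂)) + ρ·D(κ₁,κ₂)` is convex on `[0,1]²`, and
its maximum over `[0,1]²` is attained at one of the four vertices. -/
theorem encoder_best_response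
    (a b c d : ℝ) (ha : 0 < a) (hb : 0 < b) (hc : 0 < c) (hd : 0 < d)
    (hsum : a + b + c + d = 1)
    (δ₁ δ₂ ε₁ ε₂ ρ : ℝ)
    (hδ₁ : δ₁ ∈ Set.Icc (0 : ℝ) 1) (hδ₂ : δ₂ ∈ Set.Icc (0 : ℝ) 1)
    (hε₁ : ε₁ ∈ Set.Icc (0 : ℝ) 1) (hε₂ : ε₂ ∈ Set.Icc (0 : ℝ) 1)
    (hρ : 0 < ρ)
    (P₁ P₂ D g : ℝ → ℝ → ℝ)
    (hP₁ : ∀ κ₁ κ₂, P₁ κ₁ κ₂ =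
      a * (δ₁ * κ₁ + δ₂ * (1 - κ₁)) + c * (δ₁ * (1 - κ₂) + δ₂ * κ₂))
    (hP₂ : ∀ κ₁ κ₂, P₂ κ₁ κ₂ =
      b * (δ₁ * κ₂ + δ₂ * (1 - κ₂)) + d * (δ₁ * (1 - κ₁) + δ₂ * κ₁))
    (hD : ∀ κ₁ κ₂, D κ₁ κ₂ =
      a + b + ε₁ * (c + d - (κ₁ * (a + d) + κ₂ * (b + c))) +
        ε₂ * ((κ₁ * (a + d) + κ₂ * (b + c)) - (a + b)))
    (hg : ∀ κ₁ κ₂, g κ₁ κ₂ = f (a + c) (P₁ κ₁ κ₂) (P₂ κ₁ κ₂) + ρ * D κ₁ κ₂) :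
    ConvexOn ℝ (Set.Icc ((0 : ℝ), (0 : ℝ)) (1, 1))
      (fun p : ℝ × ℝ => g p.1 p.2) ∧
    ∃ v ∈ ({((0 : ℝ), (0 : ℝ)), (0, 1), (1, 0), (1, 1)} : Set (ℝ × ℝ)),
      ∀ p ∈ Set.Icc ((0 : ℝ), (0 : ℝ)) (1, 1), g p.1 p.2 ≤ g v.1 v.2 := by
  have hconv : ConvexOn ℝ (Set.Icc ((0 : ℝ), (0 : ℝ)) (1, 1))
      (fun p : ℝ × ℝ => g p.1 p.2) := by
    have bnd : ∀ x y : ℝ, 0 ≤ x → x ≤ 1 → 0 ≤ y → y ≤ 1 →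
        0 ≤ P₁ x y ∧ 0 ≤ P₂ x y ∧ P₁ x y ≤ a + c ∧ P₂ x y ≤ 1 - (a + c) := by
      intro x y hx0 hx1 hy0 hy1
      rw [hP₁, hP₂]
      obtain ⟨l1, u1⟩ := mix_mem hδ₁ hδ₂ hx0 hx1
      obtain ⟨l2, u2⟩ := mix_mem hδ₁ hδ₂ hy0 hy1
      obtain ⟨l3, u3⟩ := mix_mem hδ₂ hδ₁ hy0 hy1
      obtain ⟨l4, u4⟩ := mix_mem hδ₂ hδ₁ hx0 hx1
      rw [add_comm] at l3 u3 l4 u4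
      refine ⟨by positivity, by positivity, ?_, ?_⟩
      · have := mul_le_mul_of_nonneg_left u1 ha.le
        have := mul_le_mul_of_nonneg_left u3 hc.le
        linarith
      · have := mul_le_mul_of_nonneg_left u2 hb.le
        have := mul_le_mul_of_nonneg_left u4 hd.le
        linarith
    refine ⟨convex_Icc _ _, ?_⟩
    rintro ⟨x, y⟩ ⟨⟨hx0, hy0⟩, ⟨hx1, hy1⟩⟩ ⟨x', y'⟩ ⟨⟨hx0', hy0'⟩, ⟨hx1', hy1'⟩⟩ α β hα hβ hαβ
    simp only [Prod.smul_mk, Prod.mk_add_mk, smul_eq_mul] at *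
    obtain ⟨p1, p2, p3, p4⟩ := bnd x y hx0 hx1 hy0 hy1
    obtain ⟨r1, r2, r3, r4⟩ := bnd x' y' hx0' hx1' hy0' hy1'
    have key := f_convex p1 p2 p3 p4 r1 r2 r3 r4 hα hβ hαβ
    have hβ' : β = 1 - α := by linarith
    have e1 : P₁ (α * x + β * x') (α * y + β * y') = α * P₁ x y + β * P₁ x' y' := by
      simp only [hP₁, hβ']; ring
    have e2 : P₂ (α * x + β * x') (α * y + β * y') = α * P₂ x y + β * P₂ x' y' := by
      simp only [hP₂, hβ']; ring
    have e3 : D (α * x + β * x') (α * y + β * y') = α * D x y + β * D x' y' := by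
      simp only [hD, hβ']; ring
    rw [hg, hg, hg, e1, e2, e3]
    linarith
  exact ⟨hconv, max_vertex hconv⟩
end

section
/- (Best Response: Decoder-ŷ) Fix a symmetric encoder (κ₁,κ₂) ∈ [0,1]². The map (δ₁,δ₂) ↦ f(P₁(δ₁,δ₂), P₂(δ₁,δ₂)) is convex on [0,1]², its values at (δ₁,δ₂)=(0,1) and at (δ₁,δ₂)=(1,0) are equal, and its maximum over [0,1]² is attained at (δ₁,δ₂)=(0,1) (and hence also at (1,0)). -/
open Real

/-- The homogeneous building block (natural logs). -/
noncomputable def GG (x y : ℝ) : ℝ := negMulLog (x + y) - negMulLog x - negMulLog y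

lemma term_le (x X s S : ℝ) (hx : 0 ≤ x) (hX : x ≤ X) (hs : x ≤ s) (hS : s ≤ S) :
    x * log X - x * log S ≤ x * log x - x * log s + X / S * s - x := by
  rcases hx.eq_or_lt with h | h
  · subst h
    have : 0 ≤ X / S * s := by
      have := hs.trans hS
      positivity
    linarith
  · have hX0 : 0 < X := by linarith
    have hs0 : 0 < s := by linarith
    have hS0 : 0 < S := by linarith
    have h1 := log_le_sub_one_of_pos (x := X * s / (S * x)) (by positivity)
    rw [log_div (by positivity) (by positivity), log_mul hX0.ne' hs0.ne',
      log_mul hS0.ne' h.ne'] at h1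
    have h2 := mul_le_mul_of_nonneg_left h1 hx
    have h3 : x * (X * s / (S * x) - 1) = X / S * s - x := by field_simp
    linarith

lemma GG_half (x y X Y : ℝ) (hx : 0 ≤ x) (hy : 0 ≤ y) (hX : x ≤ X) (hY : y ≤ Y) :
    x * log X + y * log Y - (x + y) * log (X + Y) ≤ GG x y := by
  have h1 := term_le x X (x + y) (X + Y) hx hX (by linarith) (by linarith)
  have h2 := term_le y Y (x + y) (X + Y) hy hY (by linarith) (by linarith)
  have h3 : X / (X + Y) * (x + y) + Y / (X + Y) * (x + y) = x + y := by
    by_cases h : X + Y = 0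
    · have : x + y = 0 := by linarith
      simp [this]
    · field_simp
  unfold GG negMulLog
  linarith

lemma GG_add (x y x' y' : ℝ) (hx : 0 ≤ x) (hy : 0 ≤ y) (hx' : 0 ≤ x') (hy' : 0 ≤ y') :
    GG (x + x') (y + y') ≤ GG x y + GG x' y' := by
  have h1 := GG_half x y (x + x') (y + y') hx hy (by linarith) (by linarith)
  have h2 := GG_half x' y' (x + x') (y + y') hx' hy' (by linarith) (by linarith)
  have h3 : GG (x + x') (y + y') = (x + x') * log (x + x') + (y + y') * log (y + y')
      - (x + x' + (y + y')) * log (x + x' + (y + y')) := by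
    unfold GG negMulLog; ring
  rw [h3]
  linarith

lemma GG_smul (t x y : ℝ) : GG (t * x) (t * y) = t * GG x y := by
  unfold GG
  rw [← mul_add, negMulLog_mul, negMulLog_mul, negMulLog_mul]
  ring

lemma GG_conv (s t x y x' y' : ℝ) (hs : 0 ≤ s) (ht : 0 ≤ t)
    (hx : 0 ≤ x) (hy : 0 ≤ y) (hx' : 0 ≤ x') (hy' : 0 ≤ y') :
    GG (s * x + t * x') (s * y + t * y') ≤ s * GG x y + t * GG x' y' := by
  rw [← GG_smul, ← GG_smul]
  apply GG_add <;> positivity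

lemma f_eq_s6 (q P Q : ℝ) :
    f q P Q = Hb q + (GG P Q + GG (q - P) (1 - q - Q)) / log 2 := by
  have : q - P + (1 - q - Q) = 1 - (P + Q) := by ring
  unfold f GG negMulLog
  rw [this]
  simp only [Hb, logb]
  ring

lemma f_conv (q s t P Q P' Q' : ℝ) (hs : 0 ≤ s) (ht : 0 ≤ t) (hst : s + t = 1)
    (h1 : 0 ≤ P) (h2 : P ≤ q) (h3 : 0 ≤ Q) (h4 : Q ≤ 1 - q)
    (h1' : 0 ≤ P') (h2' : P' ≤ q) (h3' : 0 ≤ Q') (h4' : Q' ≤ 1 - q) :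
    f q (s * P + t * P') (s * Q + t * Q') ≤ s * f q P Q + t * f q P' Q' := by
  have hl : 0 < log 2 := log_pos (by norm_num)
  have e1 := GG_conv s t P Q P' Q' hs ht h1 h3 h1' h3'
  have e2 := GG_conv s t (q - P) (1 - q - Q) (q - P') (1 - q - Q') hs ht
    (by linarith) (by linarith) (by linarith) (by linarith)
  have g1 : s * (q - P) + t * (q - P') = q - (s * P + t * P') := by
    linear_combination q * hst
  have g2 : s * (1 - q - Q) + t * (1 - q - Q') = 1 - q - (s * Q + t * Q') := by
    linear_combination (1 - q) * hst
  rw [g1, g2] at e2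
  simp only [f_eq_s6]
  have e3 := div_le_div_of_nonneg_right (add_le_add e1 e2) hl.le
  have e4 : s * (Hb q + (GG P Q + GG (q - P) (1 - q - Q)) / log 2) +
      t * (Hb q + (GG P' Q' + GG (q - P') (1 - q - Q')) / log 2) = Hb q +
      (s * GG P Q + t * GG P' Q' + (s * GG (q - P) (1 - q - Q) +
        t * GG (q - P') (1 - q - Q'))) / log 2 := by
    linear_combination (Hb q) * hst
  rw [e4]
  linarith

lemma f_symm (q P Q : ℝ) : f q (q - P) (1 - q - Q) = f q P Q := by
  rw [f_eq_s6, f_eq_s6, sub_sub_cancel, sub_sub_cancel, add_comm (GG _ _)]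

lemma f_zero (q : ℝ) : f q 0 0 = 0 := by
  simp [f, Hb]
  ring

/-- (Best Response: Decoder-ŷ.) For a fixed symmetric encoder `(κ₁,κ₂)`, the
map `(δ₁,δ₂) ↦ f(P₁(δ₁,δ₂), P₂(δ₁,δ₂))` is convex on `[0,1]²`, takes equal
values at `(0,1)` and `(1,0)`, and attains its maximum over `[0,1]²` at
`(δ₁,δ₂) = (0,1)` (hence also at `(1,0)`). -/
theorem decoder_y_best_response
    (a b c d : ℝ) (ha : 0 < a) (hb : 0 < b) (hc : 0 < c) (hd : 0 < d)
    (hsum : a + b + c + d = 1)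
    (κ₁ κ₂ : ℝ)
    (hκ₁ : κ₁ ∈ Set.Icc (0 : ℝ) 1) (hκ₂ : κ₂ ∈ Set.Icc (0 : ℝ) 1)
    (P₁ P₂ : ℝ → ℝ → ℝ)
    (hP₁ : ∀ δ₁ δ₂, P₁ δ₁ δ₂ =
      a * (δ₁ * κ₁ + δ₂ * (1 - κ₁)) + c * (δ₁ * (1 - κ₂) + δ₂ * κ₂))
    (hP₂ : ∀ δ₁ δ₂, P₂ δ₁ δ₂ =
      b * (δ₁ * κ₂ + δ₂ * (1 - κ₂)) + d * (δ₁ * (1 - κ₁) + δ₂ * κ₁)) :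
    ConvexOn ℝ (Set.Icc ((0 : ℝ), (0 : ℝ)) (1, 1))
      (fun p : ℝ × ℝ => f (a + c) (P₁ p.1 p.2) (P₂ p.1 p.2)) ∧
    f (a + c) (P₁ 0 1) (P₂ 0 1) = f (a + c) (P₁ 1 0) (P₂ 1 0) ∧
    ∀ p ∈ Set.Icc ((0 : ℝ), (0 : ℝ)) (1, 1),
      f (a + c) (P₁ p.1 p.2) (P₂ p.1 p.2) ≤ f (a + c) (P₁ 0 1) (P₂ 0 1) := by
  obtain ⟨k1, k1'⟩ := hκ₁
  obtain ⟨k2, k2'⟩ := hκ₂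
  have m1 : 0 ≤ 1 - κ₁ := by linarith
  have m2 : 0 ≤ 1 - κ₂ := by linarith
  -- range facts
  have hr : ∀ x y : ℝ, 0 ≤ x → 0 ≤ y → x ≤ 1 → y ≤ 1 →
      0 ≤ P₁ x y ∧ P₁ x y ≤ a + c ∧ 0 ≤ P₂ x y ∧ P₂ x y ≤ 1 - (a + c) := by
    intro x y hx hy hx1 hy1
    have key : ∀ k : ℝ, 0 ≤ k → k ≤ 1 → x * k + y * (1 - k) ≤ 1 := by
      intro k hk hk1
      nlinarith [mul_le_mul_of_nonneg_right hx1 hk,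
        mul_le_mul_of_nonneg_right hy1 (sub_nonneg.2 hk1)]
    have l1 := key κ₁ k1 k1'
    have l2 := key κ₂ k2 k2'
    have l3 := key (1 - κ₁) m1 (by linarith)
    have l4 := key (1 - κ₂) m2 (by linarith)
    rw [sub_sub_cancel] at l3 l4
    rw [hP₁, hP₂]
    refine ⟨by positivity, ?_, by positivity, ?_⟩
    · linarith [mul_le_mul_of_nonneg_left l1 ha.le, mul_le_mul_of_nonneg_left l4 hc.le]
    · linarith [mul_le_mul_of_nonneg_left l2 hb.le, mul_le_mul_of_nonneg_left l3 hd.le]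
  -- convexity along segments, in coordinates
  have hcv : ∀ s t x y x' y' : ℝ, 0 ≤ s → 0 ≤ t → s + t = 1 →
      0 ≤ x → 0 ≤ y → x ≤ 1 → y ≤ 1 → 0 ≤ x' → 0 ≤ y' → x' ≤ 1 → y' ≤ 1 →
      f (a + c) (P₁ (s * x + t * x') (s * y + t * y')) (P₂ (s * x + t * x') (s * y + t * y'))
        ≤ s * f (a + c) (P₁ x y) (P₂ x y) + t * f (a + c) (P₁ x' y') (P₂ x' y') := by
    intro s t x y x' y' hs ht hst h1 h2 h3 h4 h1' h2' h3' h4'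
    obtain ⟨r1, r2, r3, r4⟩ := hr x y h1 h2 h3 h4
    obtain ⟨r1', r2', r3', r4'⟩ := hr x' y' h1' h2' h3' h4'
    have := f_conv (a + c) s t _ _ _ _ hs ht hst r1 r2 r3 r4 r1' r2' r3' r4'
    have e1 : P₁ (s * x + t * x') (s * y + t * y') = s * P₁ x y + t * P₁ x' y' := by
      simp only [hP₁]; ring
    have e2 : P₂ (s * x + t * x') (s * y + t * y') = s * P₂ x y + t * P₂ x' y' := by
      simp only [hP₂]; ring
    rw [e1, e2]
    exact this
  have hsym : f (a + c) (P₁ 0 1) (P₂ 0 1) = f (a + c) (P₁ 1 0) (P₂ 1 0) := by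
    rw [← f_symm]
    congr 1
    · simp only [hP₁]; ring
    · simp only [hP₂]; linear_combination -hsum
  have h00 : f (a + c) (P₁ 0 0) (P₂ 0 0) = 0 := by
    have e1 : P₁ 0 0 = 0 := by rw [hP₁]; ring
    have e2 : P₂ 0 0 = 0 := by rw [hP₂]; ring
    rw [e1, e2, f_zero]
  have h11 : f (a + c) (P₁ 1 1) (P₂ 1 1) = 0 := by
    rw [← f_symm, ← f_zero (a + c)]
    congr 1
    · simp only [hP₁]; ring
    · simp only [hP₂]; linear_combination -hsum
  have hhalf : f (a + c) (P₁ (1/2) (1/2)) (P₂ (1/2) (1/2)) = 0 := by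
    have e1 : P₁ (1/2) (1/2) = 1/2 * (a + c) := by rw [hP₁]; ring
    have e2 : P₂ (1/2) (1/2) = 1/2 * (1 - (a + c)) := by
      rw [hP₂]; linear_combination (1/2) * hsum
    have e3 : a + c - 1/2 * (a + c) = 1/2 * (a + c) := by ring
    have e4 : 1 - (a + c) - 1/2 * (1 - (a + c)) = 1/2 * (1 - (a + c)) := by ring
    rw [e1, e2, f_eq_s6, e3, e4, GG_smul]
    have := f_eq_s6 (a + c) 0 0
    rw [f_zero] at this
    have e5 : GG 0 0 = 0 := by simp [GG]
    rw [e5, sub_zero, sub_zero] at this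
    linear_combination -this
  have hM : 0 ≤ f (a + c) (P₁ 0 1) (P₂ 0 1) := by
    have := hcv (1/2) (1/2) 0 1 1 0 (by norm_num) (by norm_num) (by norm_num) (by norm_num)
      (by norm_num) (by norm_num) (by norm_num) (by norm_num) (by norm_num) (by norm_num)
      (by norm_num)
    rw [← hsym] at this
    norm_num only at this hhalf
    rw [hhalf] at this
    linarith
  refine ⟨⟨convex_Icc _ _, ?_⟩, hsym, ?_⟩
  · rintro ⟨x, y⟩ ⟨⟨h1, h2⟩, ⟨h3, h4⟩⟩ ⟨x', y'⟩ ⟨⟨h1', h2'⟩, ⟨h3', h4'⟩⟩ s t hs ht hst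
    exact hcv s t x y x' y' hs ht hst h1 h2 h3 h4 h1' h2' h3' h4'
  · rintro ⟨x, y⟩ ⟨⟨h1, h2⟩, ⟨h3, h4⟩⟩
    simp only at h1 h2 h3 h4 ⊢
    set M := f (a + c) (P₁ 0 1) (P₂ 0 1) with hMdef
    have edge1 : ∀ r : ℝ, 0 ≤ r → r ≤ 1 → f (a + c) (P₁ r 1) (P₂ r 1) ≤ M := by
      intro r hr0 hr1
      have := hcv (1 - r) r 0 1 1 1 (by linarith) hr0 (by ring) le_rfl zero_le_one
        zero_le_one le_rfl zero_le_one zero_le_one le_rfl le_rfl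
      have e1 : (1 - r) * 0 + r * 1 = r := by ring
      have e2 : (1 - r) * 1 + r * 1 = 1 := by ring
      rw [e1, e2, h11, ← hMdef] at this
      nlinarith
    have edge2 : ∀ r : ℝ, 0 ≤ r → r ≤ 1 → f (a + c) (P₁ 1 r) (P₂ 1 r) ≤ M := by
      intro r hr0 hr1
      have := hcv (1 - r) r 1 0 1 1 (by linarith) hr0 (by ring) zero_le_one le_rfl
        le_rfl zero_le_one zero_le_one zero_le_one le_rfl le_rfl
      have e1 : (1 - r) * 0 + r * 1 = r := by ring
      have e2 : (1 - r) * 1 + r * 1 = 1 := by ring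
      rw [e1, e2, h11, ← hsym] at this
      nlinarith
    rcases le_total x y with hxy | hxy
    · rcases h2.eq_or_lt with h0 | h0
      · have hx0 : x = 0 := by linarith
        rw [hx0, ← h0, h00]; exact hM
      · have hq : x / y ≤ 1 := (div_le_one h0).2 hxy
        have hq0 : 0 ≤ x / y := by positivity
        have := hcv (1 - y) y 0 0 (x / y) 1 (by linarith) h2 (by ring) le_rfl le_rfl
          zero_le_one zero_le_one hq0 zero_le_one hq le_rfl
        have e1 : (1 - y) * 0 + y * (x / y) = x := by field_simp; ring
        have e2 : (1 - y) * 0 + y * 1 = y := by ring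
        rw [e1, e2, h00] at this
        nlinarith [edge1 _ hq0 hq]
    · rcases h1.eq_or_lt with h0 | h0
      · have hy0 : y = 0 := by linarith
        rw [hy0, ← h0, h00]; exact hM
      · have hq : y / x ≤ 1 := (div_le_one h0).2 hxy
        have hq0 : 0 ≤ y / x := by positivity
        have := hcv (1 - x) x 0 0 1 (y / x) (by linarith) h1 (by ring) le_rfl le_rfl
          zero_le_one zero_le_one zero_le_one hq0 le_rfl hq
        have e1 : (1 - x) * 0 + x * (y / x) = y := by field_simp; ring
        have e2 : (1 - x) * 0 + x * 1 = x := by ring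
        rw [e1, e2, h00] at this
        nlinarith [edge2 _ hq0 hq]
end

section
/- Fix decoder-ŷ parameters (δ₁,δ₂) = (1,0), so that P₁(κ₁,κ₂) = a·κ₁ + c·(1−κ₂) and P₂(κ₁,κ₂) = b·κ₂ + d·(1−κ₁). Then: (i) for (κ₁,κ₂) = (0,1) and for (κ₁,κ₂) = (1,0), f(P₁,P₂) = H_b(a+c); (ii) for (κ₁,κ₂) = (0,0) and for (κ₁,κ₂) = (1,1), f(P₁,P₂) = H_b(a+c) + H_b(a+b) + a·log₂ a + b·log₂ b + c·log₂ c + d·log₂ d, which is strictly less than H_b(a+c). -/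
open Real

/-- With the decoder-ŷ fixed at `(δ₁,δ₂) = (1,0)`, the informative encoder
vertices `(κ₁,κ₂) ∈ {(0,1),(1,0)}` achieve mutual information `H_b(a+c)`,
while the uninformative vertices `(0,0)` and `(1,1)` achieve the strictly
smaller value `H_b(a+c) + H_b(a+b) + a log₂ a + b log₂ b + c log₂ c + d log₂ d`. -/
theorem encoder_vertices_mutual_info
    (a b c d : ℝ) (ha : 0 < a) (hb : 0 < b) (hc : 0 < c) (hd : 0 < d)
    (hsum : a + b + c + d = 1)
    (P₁ P₂ : ℝ → ℝ → ℝ)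
    (hP₁ : ∀ κ₁ κ₂, P₁ κ₁ κ₂ = a * κ₁ + c * (1 - κ₂))
    (hP₂ : ∀ κ₁ κ₂, P₂ κ₁ κ₂ = b * κ₂ + d * (1 - κ₁)) :
    f (a + c) (P₁ 0 1) (P₂ 0 1) = Hb (a + c) ∧
    f (a + c) (P₁ 1 0) (P₂ 1 0) = Hb (a + c) ∧
    f (a + c) (P₁ 0 0) (P₂ 0 0) =
      Hb (a + c) + Hb (a + b) + a * Real.logb 2 a + b * Real.logb 2 b +
        c * Real.logb 2 c + d * Real.logb 2 d ∧
    f (a + c) (P₁ 1 1) (P₂ 1 1) =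
      Hb (a + c) + Hb (a + b) + a * Real.logb 2 a + b * Real.logb 2 b +
        c * Real.logb 2 c + d * Real.logb 2 d ∧
    Hb (a + c) + Hb (a + b) + a * Real.logb 2 a + b * Real.logb 2 b +
        c * Real.logb 2 c + d * Real.logb 2 d < Hb (a + c) := by
  have key : ∀ x y : ℝ, 0 < x → 0 < y →
      x * Real.logb 2 x + y * Real.logb 2 y < (x + y) * Real.logb 2 (x + y) := by
    intro x y hx hy
    have h1 : Real.logb 2 x < Real.logb 2 (x + y) :=
      Real.logb_lt_logb (by norm_num) hx (by linarith)
    have h2 : Real.logb 2 y < Real.logb 2 (x + y) :=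
      Real.logb_lt_logb (by norm_num) hy (by linarith)
    nlinarith [mul_lt_mul_of_pos_left h1 hx, mul_lt_mul_of_pos_left h2 hy]
  have hab := key a b ha hb
  have hcd := key c d hc hd
  have e1 : 1 - (a + b) = c + d := by linarith
  have e2 : 1 - (c + d) = a + b := by linarith
  have e3 : 1 - (b + d) = a + c := by linarith
  have e4 : 1 - (a + c) = b + d := by linarith
  have e5 : b + d - d = b := by ring
  have e6 : b + d - b = d := by ring
  have e7 : a + c - c = a := by ring
  have e8 : a + c - a = c := by ring
  simp only [f, Hb, hP₁, hP₂, mul_zero, mul_one, sub_self, sub_zero, zero_add, add_zero,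
    e1, e2, e3, e4, e5, e6, e7, e8, zero_mul]
  refine ⟨by ring, by ring, by ring, ?_⟩
  exact ⟨trivial, by linarith⟩
end

section
/- (Stackelberg equilibrium) Let ρ > 0. For every symmetric encoder (κ₁,κ₂) ∈ [0,1]² and every decoder-ŷ parameter pair (δ₁,δ₂) ∈ [0,1]², with θ = κ₁(a+d)+κ₂(b+c), one has f(P₁,P₂) + ρ·min{a+b, c+d, θ, 1−θ} ≤ H_b(a+c) + ρ·min{a+b, c+d}. Moreover, if min{a+b, c+d} ≤ min{a+d, b+c}, then equality holds at (κ₁,κ₂) = (0,1) and (δ₁,δ₂) = (1,0); i.e., under this prior condition the encoder strategy (κ₁,κ₂)=(0,1) together with the decoder best responses attains the Stackelberg value H_b(a+c) + ρ·min{a+b, c+d}. -/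
open Real

theorem aux_xlogx (x y : ℝ) (hx : 0 ≤ x) (hy : 0 ≤ y) :
    x * Real.logb 2 x + y * Real.logb 2 y ≤ (x + y) * Real.logb 2 (x + y) := by
  have key : ∀ u v : ℝ, 0 ≤ u → 0 ≤ v → u * Real.logb 2 u ≤ u * Real.logb 2 (u + v) := by
    intro u v hu hv
    rcases hu.eq_or_lt with h | h
    · simp [← h]
    · exact mul_le_mul_of_nonneg_left
        (Real.logb_le_logb_of_le (by norm_num) h (by linarith)) hu
  have h1 := key x y hx hy
  have h2 := key y x hy hx
  rw [add_comm y x] at h2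
  linarith

theorem aux_f_le (q x y : ℝ) (hx : 0 ≤ x) (hy : 0 ≤ y) (hu : 0 ≤ q - x) (hv : 0 ≤ 1 - q - y) :
    f q x y ≤ Hb q := by
  have h1 := aux_xlogx x y hx hy
  have h2 := aux_xlogx (q - x) (1 - q - y) hu hv
  have e : q - x + (1 - q - y) = 1 - (x + y) := by ring
  rw [e] at h2
  unfold f
  have e2 : Hb (x + y) = -((x + y) * Real.logb 2 (x + y))
    - (1 - (x + y)) * Real.logb 2 (1 - (x + y)) := rfl
  rw [e2]
  linarith

theorem aux_mix (s t k : ℝ) (hs : s ∈ Set.Icc (0 : ℝ) 1) (ht : t ∈ Set.Icc (0 : ℝ) 1)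
    (hk : k ∈ Set.Icc (0 : ℝ) 1) :
    0 ≤ s * k + t * (1 - k) ∧ s * k + t * (1 - k) ≤ 1 := by
  obtain ⟨s0, s1⟩ := hs
  obtain ⟨t0, t1⟩ := ht
  obtain ⟨k0, k1⟩ := hk
  constructor
  · nlinarith [mul_nonneg s0 k0, mul_nonneg t0 (sub_nonneg.2 k1)]
  · nlinarith [mul_nonneg (sub_nonneg.2 s1) k0, mul_nonneg (sub_nonneg.2 t1) (sub_nonneg.2 k1)]

/-- (Stackelberg equilibrium.) For every symmetric encoder `(κ₁,κ₂)` and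
decoder-ŷ parameters `(δ₁,δ₂)` in `[0,1]²`, the encoder payoff after the
decoder-x̂ best response is at most `H_b(a+c) + ρ·min{a+b, c+d}`; and if
`min{a+b, c+d} ≤ min{a+d, b+c}`, this value is attained at
`(κ₁,κ₂) = (0,1)`, `(δ₁,δ₂) = (1,0)`. -/
theorem stackelberg_equilibrium
    (a b c d : ℝ) (ha : 0 < a) (hb : 0 < b) (hc : 0 < c) (hd : 0 < d)
    (hsum : a + b + c + d = 1)
    (ρ : ℝ) (hρ : 0 < ρ)
    (P₁ P₂ : ℝ → ℝ → ℝ → ℝ → ℝ) (θ : ℝ → ℝ → ℝ)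
    (hP₁ : ∀ κ₁ κ₂ δ₁ δ₂, P₁ κ₁ κ₂ δ₁ δ₂ =
      a * (δ₁ * κ₁ + δ₂ * (1 - κ₁)) + c * (δ₁ * (1 - κ₂) + δ₂ * κ₂))
    (hP₂ : ∀ κ₁ κ₂ δ₁ δ₂, P₂ κ₁ κ₂ δ₁ δ₂ =
      b * (δ₁ * κ₂ + δ₂ * (1 - κ₂)) + d * (δ₁ * (1 - κ₁) + δ₂ * κ₁))
    (hθ : ∀ κ₁ κ₂, θ κ₁ κ₂ = κ₁ * (a + d) + κ₂ * (b + c)) :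
    (∀ κ₁ ∈ Set.Icc (0 : ℝ) 1, ∀ κ₂ ∈ Set.Icc (0 : ℝ) 1,
      ∀ δ₁ ∈ Set.Icc (0 : ℝ) 1, ∀ δ₂ ∈ Set.Icc (0 : ℝ) 1,
        f (a + c) (P₁ κ₁ κ₂ δ₁ δ₂) (P₂ κ₁ κ₂ δ₁ δ₂) +
            ρ * min (min (a + b) (c + d)) (min (θ κ₁ κ₂) (1 - θ κ₁ κ₂)) ≤
          Hb (a + c) + ρ * min (a + b) (c + d)) ∧
    (min (a + b) (c + d) ≤ min (a + d) (b + c) →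
      f (a + c) (P₁ 0 1 1 0) (P₂ 0 1 1 0) +
          ρ * min (min (a + b) (c + d)) (min (θ 0 1) (1 - θ 0 1)) =
        Hb (a + c) + ρ * min (a + b) (c + d)) := by
  constructor
  · intro κ₁ h1 κ₂ h2 δ₁ g1 δ₂ g2
    have hm := mul_le_mul_of_nonneg_left
      (min_le_left (min (a + b) (c + d)) (min (θ κ₁ κ₂) (1 - θ κ₁ κ₂))) hρ.le
    have hf : f (a + c) (P₁ κ₁ κ₂ δ₁ δ₂) (P₂ κ₁ κ₂ δ₁ δ₂) ≤ Hb (a + c) := by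
      obtain ⟨l1, u1⟩ := aux_mix δ₁ δ₂ κ₁ g1 g2 h1
      obtain ⟨l2, u2⟩ := aux_mix δ₁ δ₂ κ₂ g1 g2 h2
      obtain ⟨l3, u3⟩ := aux_mix δ₂ δ₁ κ₂ g2 g1 h2
      obtain ⟨l4, u4⟩ := aux_mix δ₂ δ₁ κ₁ g2 g1 h1
      rw [add_comm (δ₂ * _)] at l3 u3 l4 u4
      rw [hP₁, hP₂]
      apply aux_f_le
      · positivity
      · positivity
      · linarith [mul_le_mul_of_nonneg_left u1 ha.le, mul_le_mul_of_nonneg_left u3 hc.le]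
      · linarith [mul_le_mul_of_nonneg_left u2 hb.le, mul_le_mul_of_nonneg_left u4 hd.le]
    linarith
  · intro h
    have e1 : P₁ 0 1 1 0 = 0 := by rw [hP₁]; ring
    have e2 : P₂ 0 1 1 0 = 1 - (a + c) := by rw [hP₂]; linarith
    have e3 : θ 0 1 = b + c := by rw [hθ]; ring
    have e4 : 1 - (b + c) = a + d := by linarith
    rw [e1, e2, e3, e4, min_comm (b + c), min_eq_left h]
    simp [f, Hb]
    ring
end

section
/- (Nash equilibrium: existence) Let ρ > 0 and suppose min{a+b, c+d} ≤ min{a+d, b+c}. Define the encoder objective J^e(κ,δ,ε) = f(P₁,P₂) + ρ·D(κ₁,κ₂,ε₁,ε₂) and the decoder objective J^d(κ,δ,ε) = f(P₁,P₂) − D(κ₁,κ₂,ε₁,ε₂). Let κ* = (0,1), δ* = (1,0), and ε* = (0,0) if a+b ≤ c+d, ε* = (1,1) if c+d ≤ a+b. Then (κ*,δ*,ε*) is a Nash equilibrium: J^e(κ,δ*,ε*) ≤ J^e(κ*,δ*,ε*) for every (κ₁,κ₂) ∈ [0,1]², and J^d(κ*,δ,ε) ≤ J^d(κ*,δ*,ε*)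 for every (δ₁,δ₂) ∈ [0,1]² and every (ε₁,ε₂) ∈ [0,1]². -/
open Real

lemma mul_logb_mono (x y : ℝ) (hx : 0 ≤ x) (hxy : x ≤ y) :
    x * Real.logb 2 x ≤ x * Real.logb 2 y := by
  rcases hx.eq_or_lt with h | h
  · simp [← h]
  · exact mul_le_mul_of_nonneg_left (Real.logb_le_logb_of_le (by norm_num) h hxy) hx

lemma f_le (q P₁ P₂ : ℝ) (h1 : 0 ≤ P₁) (h1' : P₁ ≤ q) (h2 : 0 ≤ P₂) (h2' : P₂ ≤ 1 - q) :
    f q P₁ P₂ ≤ Hb q := by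
  have e1 := mul_logb_mono P₁ (P₁ + P₂) h1 (by linarith)
  have e2 := mul_logb_mono P₂ (P₁ + P₂) h2 (by linarith)
  have e3 := mul_logb_mono (q - P₁) (1 - (P₁ + P₂)) (by linarith) (by linarith)
  have e4 := mul_logb_mono (1 - q - P₂) (1 - (P₁ + P₂)) (by linarith) (by linarith)
  have : f q P₁ P₂ = Hb q + (P₁ * Real.logb 2 P₁ - P₁ * Real.logb 2 (P₁ + P₂))
      + (P₂ * Real.logb 2 P₂ - P₂ * Real.logb 2 (P₁ + P₂))
      + ((q - P₁) * Real.logb 2 (q - P₁) - (q - P₁) * Real.logb 2 (1 - (P₁ + P₂)))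
      + ((1 - q - P₂) * Real.logb 2 (1 - q - P₂)
        - (1 - q - P₂) * Real.logb 2 (1 - (P₁ + P₂))) := by
    simp only [f, Hb]; ring
  linarith

lemma f_star (q : ℝ) : f q 0 (1 - q) = Hb q := by
  simp [f, Hb]
  ring

lemma mix_mem_s17 (x y s t : ℝ) (hx : 0 ≤ x) (hy : 0 ≤ y) (hs : s ∈ Set.Icc (0 : ℝ) 1)
    (ht : t ∈ Set.Icc (0 : ℝ) 1) : 0 ≤ x * s + y * t ∧ x * s + y * t ≤ x + y := by
  obtain ⟨s0, s1⟩ := hs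
  obtain ⟨t0, t1⟩ := ht
  constructor
  · positivity
  · nlinarith

/-- (Nash equilibrium: existence.) If `min{a+b, c+d} ≤ min{a+d, b+c}`, then
`κ* = (0,1)`, `δ* = (1,0)` and `ε* = (0,0)` (when `a+b ≤ c+d`) or
`ε* = (1,1)` (when `c+d ≤ a+b`) form a Nash equilibrium: no unilateral
deviation by the encoder or the decoder is profitable. -/
theorem nash_equilibrium_existence
    (a b c d : ℝ) (ha : 0 < a) (hb : 0 < b) (hc : 0 < c) (hd : 0 < d)
    (hsum : a + b + c + d = 1)
    (ρ : ℝ) (hρ : 0 < ρ)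
    (hmin : min (a + b) (c + d) ≤ min (a + d) (b + c))
    (P₁ P₂ : ℝ → ℝ → ℝ → ℝ → ℝ) (D : ℝ → ℝ → ℝ → ℝ → ℝ)
    (Je Jd : ℝ → ℝ → ℝ → ℝ → ℝ → ℝ → ℝ)
    (hP₁ : ∀ κ₁ κ₂ δ₁ δ₂, P₁ κ₁ κ₂ δ₁ δ₂ =
      a * (δ₁ * κ₁ + δ₂ * (1 - κ₁)) + c * (δ₁ * (1 - κ₂) + δ₂ * κ₂))
    (hP₂ : ∀ κ₁ κ₂ δ₁ δ₂, P₂ κ₁ κ₂ δ₁ δ₂ =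
      b * (δ₁ * κ₂ + δ₂ * (1 - κ₂)) + d * (δ₁ * (1 - κ₁) + δ₂ * κ₁))
    (hD : ∀ κ₁ κ₂ ε₁ ε₂, D κ₁ κ₂ ε₁ ε₂ =
      a + b + ε₁ * (c + d - (κ₁ * (a + d) + κ₂ * (b + c))) +
        ε₂ * ((κ₁ * (a + d) + κ₂ * (b + c)) - (a + b)))
    (hJe : ∀ κ₁ κ₂ δ₁ δ₂ ε₁ ε₂, Je κ₁ κ₂ δ₁ δ₂ ε₁ ε₂ =
      f (a + c) (P₁ κ₁ κ₂ δ₁ δ₂) (P₂ κ₁ κ₂ δ₁ δ₂) + ρ * D κ₁ κ₂ ε₁ ε₂)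
    (hJd : ∀ κ₁ κ₂ δ₁ δ₂ ε₁ ε₂, Jd κ₁ κ₂ δ₁ δ₂ ε₁ ε₂ =
      f (a + c) (P₁ κ₁ κ₂ δ₁ δ₂) (P₂ κ₁ κ₂ δ₁ δ₂) - D κ₁ κ₂ ε₁ ε₂)
    (ε₁star ε₂star : ℝ)
    (hεstar : (a + b ≤ c + d ∧ ε₁star = 0 ∧ ε₂star = 0) ∨
              (c + d ≤ a + b ∧ ε₁star = 1 ∧ ε₂star = 1)) :
    (∀ κ₁ ∈ Set.Icc (0 : ℝ) 1, ∀ κ₂ ∈ Set.Icc (0 : ℝ) 1,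
      Je κ₁ κ₂ 1 0 ε₁star ε₂star ≤ Je 0 1 1 0 ε₁star ε₂star) ∧
    (∀ δ₁ ∈ Set.Icc (0 : ℝ) 1, ∀ δ₂ ∈ Set.Icc (0 : ℝ) 1,
      ∀ ε₁ ∈ Set.Icc (0 : ℝ) 1, ∀ ε₂ ∈ Set.Icc (0 : ℝ) 1,
        Jd 0 1 δ₁ δ₂ ε₁ ε₂ ≤ Jd 0 1 1 0 ε₁star ε₂star) := by
  have hq : b + d = 1 - (a + c) := by linarith
  have hfstar : f (a + c) (P₁ 0 1 1 0) (P₂ 0 1 1 0) = Hb (a + c) := by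
    rw [hP₁, hP₂, ← f_star (a + c), ← hq]
    congr 1 <;> ring
  constructor
  · intro κ₁ h1 κ₂ h2
    have h1' : 1 - κ₁ ∈ Set.Icc (0 : ℝ) 1 := ⟨by linarith [h1.2], by linarith [h1.1]⟩
    have h2' : 1 - κ₂ ∈ Set.Icc (0 : ℝ) 1 := ⟨by linarith [h2.2], by linarith [h2.1]⟩
    have m1 := mix_mem_s17 a c κ₁ (1 - κ₂) ha.le hc.le h1 h2'
    have m2 := mix_mem_s17 b d κ₂ (1 - κ₁) hb.le hd.le h2 h1'
    have e1 : P₁ κ₁ κ₂ 1 0 = a * κ₁ + c * (1 - κ₂) := by rw [hP₁]; ring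
    have e2 : P₂ κ₁ κ₂ 1 0 = b * κ₂ + d * (1 - κ₁) := by rw [hP₂]; ring
    have hf := f_le (a + c) _ _ m1.1 m1.2 m2.1 (hq ▸ m2.2)
    have hDD : D κ₁ κ₂ ε₁star ε₂star = D 0 1 ε₁star ε₂star := by
      rw [hD, hD]
      rcases hεstar with ⟨_, r1, r2⟩ | ⟨_, r1, r2⟩ <;> rw [r1, r2] <;> ring
    rw [hJe, hJe, hfstar, hDD, e1, e2]
    linarith
  · intro δ₁ h1 δ₂ h2 ε₁ h3 ε₂ h4
    have m1 := mix_mem_s17 a c δ₂ δ₂ ha.le hc.le h2 h2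
    have m2 := mix_mem_s17 b d δ₁ δ₁ hb.le hd.le h1 h1
    have e1 : P₁ 0 1 δ₁ δ₂ = a * δ₂ + c * δ₂ := by rw [hP₁]; ring
    have e2 : P₂ 0 1 δ₁ δ₂ = b * δ₁ + d * δ₁ := by rw [hP₂]; ring
    have hf := f_le (a + c) _ _ m1.1 m1.2 m2.1 (hq ▸ m2.2)
    have hDD : D 0 1 ε₁star ε₂star ≤ D 0 1 ε₁ ε₂ := by
      have key : ∀ m : ℝ, m ≤ a + b → m ≤ c + d → m ≤ a + d → m ≤ b + c →
          m ≤ D 0 1 ε₁ ε₂ := by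
        intro m k1 k2 k3 k4
        have x1 := sub_nonneg.2 h3.2
        have x2 := sub_nonneg.2 h4.2
        have p1 := mul_nonneg (mul_nonneg x1 x2) (sub_nonneg.2 k1)
        have p2 := mul_nonneg (mul_nonneg h3.1 h4.1) (sub_nonneg.2 k2)
        have p3 := mul_nonneg (mul_nonneg h3.1 x2) (sub_nonneg.2 k3)
        have p4 := mul_nonneg (mul_nonneg x1 h4.1) (sub_nonneg.2 k4)
        rw [hD]
        linarith
      have l1 := hmin.trans (min_le_left _ _)
      have l2 := hmin.trans (min_le_right _ _)
      rcases hεstar with ⟨hle, r1, r2⟩ | ⟨hle, r1, r2⟩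
      · rw [min_eq_left hle] at l1 l2
        have : D 0 1 ε₁star ε₂star = a + b := by rw [hD, r1, r2]; ring
        rw [this]
        exact key _ le_rfl hle l1 l2
      · rw [min_eq_right hle] at l1 l2
        have : D 0 1 ε₁star ε₂star = c + d := by rw [hD, r1, r2]; ring
        rw [this]
        exact key _ hle le_rfl l1 l2
    rw [hJd, hJd, hfstar, e1, e2]
    linarith
end

section
/- (Nash equilibrium: non-existence) Let ρ > 0 and suppose min{a+d, b+c} < min{a+b, c+d}. Set M = H_b(a+b) + a·log₂ a + b·log₂ b + c·log₂ c + d·log₂ d. Consider the 4×4 bimatrix game with rows r ∈ {1,2,3,4} (encoder vertex strategies κ₁κ₂ = 00, 01, 10, 11), columns s ∈ {1,2,3,4} (decoder-x̂ vertex strategies ε₁ε₂ = 00, 01, 10, 11), encoder payoff U (to be maximized over rows) given row-wise by U(1,·) = (M+ρ(a+b), M, M+ρ, M+ρ(c+d)), U(2,·) = (ρ(a+b), ρ(b+c), ρ(a+d), ρ(c+d)), U(3,·) = (ρ(a+b), ρ(a+d), ρ(b+c), ρ(c+d)), U(4,·) = (M+ρ(a+b), M+ρ, M, M+ρ(c+d)),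 and decoder cost V (to be minimized over columns) given row-wise by V(1,·) = (a+b, 0, 1, c+d), V(2,·) = (a+b, b+c, a+d, c+d), V(3,·) = (a+b, a+d, b+c, c+d), V(4,·) = (a+b, 1, 0, c+d). Then there is no pure Nash equilibrium: no pair (r,s) satisfies both U(r,s) ≥ U(r',s) for all rows r' and V(r,s) ≤ V(r,s') for all columns s'. -/
/-- (Nash equilibrium: non-existence.) If `min{a+d, b+c} < min{a+b, c+d}`, the
reduced 4×4 normal form of the privacy signaling game (rows: encoder vertex
strategies `κ₁κ₂ ∈ {00,01,10,11}`; columns: decoder-x̂ vertex strategies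
`ε₁ε₂ ∈ {00,01,10,11}`; encoder payoff `U` to be maximized, decoder cost `V`
to be minimized) admits no pure Nash equilibrium. -/
theorem nash_equilibrium_nonexistence
    (a b c d : ℝ) (ha : 0 < a) (hb : 0 < b) (hc : 0 < c) (hd : 0 < d)
    (hsum : a + b + c + d = 1)
    (ρ : ℝ) (hρ : 0 < ρ)
    (hmin : min (a + d) (b + c) < min (a + b) (c + d))
    (M : ℝ)
    (hM : M = (-(((a+b)) * Real.logb 2 (a+b)) - (1 - (a+b)) * Real.logb 2 (1 - (a+b))) +
      a * Real.logb 2 a + b * Real.logb 2 b + c * Real.logb 2 c + d * Real.logb 2 d)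
    (U V : Fin 4 → Fin 4 → ℝ)
    (hU : U = Matrix.of
      !![M + ρ*(a+b), M,         M + ρ,     M + ρ*(c+d);
         ρ*(a+b),     ρ*(b+c),   ρ*(a+d),   ρ*(c+d);
         ρ*(a+b),     ρ*(a+d),   ρ*(b+c),   ρ*(c+d);
         M + ρ*(a+b), M + ρ,     M,         M + ρ*(c+d)])
    (hV : V = Matrix.of
      !![a+b, 0,     1,     c+d;
         a+b, b+c,   a+d,   c+d;
         a+b, a+d,   b+c,   c+d;
         a+b, 1,     0,     c+d]) :
    ¬ ∃ r s : Fin 4,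
        (∀ r' : Fin 4, U r' s ≤ U r s) ∧ (∀ s' : Fin 4, V r s ≤ V r s') := by
  have hlog : ∀ x y : ℝ, 0 < x → x < y → x * Real.logb 2 x < x * Real.logb 2 y :=
    fun x y hx hxy =>
      mul_lt_mul_of_pos_left (Real.logb_lt_logb (by norm_num) hx hxy) hx
  have hM0 : M < 0 := by
    have e : 1 - (a + b) = c + d := by linarith
    rw [e] at hM
    have h1 := hlog a (a + b) ha (by linarith)
    have h2 := hlog b (a + b) hb (by linarith)
    have h3 := hlog c (c + d) hc (by linarith)
    have h4 := hlog d (c + d) hd (by linarith)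
    rw [hM]
    nlinarith
  have hP : 0 < ρ * (b + c) := by positivity
  have hQ : 0 < ρ * (a + d) := by positivity
  have hlt1 : min (a + d) (b + c) < a + b := lt_of_lt_of_le hmin (min_le_left _ _)
  have hlt2 : min (a + d) (b + c) < c + d := lt_of_lt_of_le hmin (min_le_right _ _)
  clear hM hmin hlog
  rintro ⟨r, s, h1, h2⟩
  have hU' : U = ![![M + ρ*(a+b), M, M + ρ, M + ρ*(c+d)],
      ![ρ*(a+b), ρ*(b+c), ρ*(a+d), ρ*(c+d)],
      ![ρ*(a+b), ρ*(a+d), ρ*(b+c), ρ*(c+d)],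
      ![M + ρ*(a+b), M + ρ, M, M + ρ*(c+d)]] := hU
  have hV' : V = ![![a+b, 0, 1, c+d], ![a+b, b+c, a+d, c+d],
      ![a+b, a+d, b+c, c+d], ![a+b, 1, 0, c+d]] := hV
  clear hU hV
  subst hU' hV'
  have u0 := h1 0
  have u1 := h1 1
  have u2 := h1 2
  have u3 := h1 3
  have v0 := h2 0
  have v1 := h2 1
  have v2 := h2 2
  have v3 := h2 3
  clear h1 h2
  have key : a + d < b + c ∧ ρ * (a + d) < ρ * (b + c) ∧ a + d < a + b ∧ a + d < c + d ∨
      b + c < a + d ∧ ρ * (b + c) < ρ * (a + d) ∧ b + c < a + b ∧ b + c < c + d := by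
    rcases le_total (a + d) (b + c) with h | h
    · rw [min_eq_left h] at hlt1 hlt2
      have h' : a + d < b + c := by linarith
      exact Or.inl ⟨h', mul_lt_mul_of_pos_left h' hρ, hlt1, hlt2⟩
    · rw [min_eq_right h] at hlt1 hlt2
      have h' : b + c < a + d := by linarith
      exact Or.inr ⟨h', mul_lt_mul_of_pos_left h' hρ, hlt1, hlt2⟩
  clear hlt1 hlt2
  fin_cases r <;> fin_cases s <;>
    simp [-mul_le_mul_iff_right₀, -mul_le_mul_iff_left₀] at u0 u1 u2 u3 v0 v1 v2 v3 <;>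
    rcases key with ⟨k1, k2, k3, k4⟩ | ⟨k1, k2, k3, k4⟩ <;> nlinarith
end
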